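/- arXiv:1501.02994 — 2 statements merged into one kernel-verified Lean document; each statement's English description precedes it below -/
import Mathlib

section
/- The zero set of Θ_q in ℂ* is exactly the discrete q-spiral −q^ℤ := {−q^k : k ∈ ℤ}, and every zero is simple: for each k ∈ ℤ, the order of vanishing of the analytic function Θ_q at the point −q^k equals 1. -/
/-- The theta function `Θ_Q(z) = Σ_{ℓ ∈ ℤ} Q^(-ℓ(ℓ+1)/2) z^ℓ`. -/
noncomputable def theta (Q z : ℂ) : ℂ := ∑' ℓ : ℤ, Q ^ (-(ℓ * (ℓ + 1)) / 2) * z ^ ℓ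

open Filter Topology Finset

/-- The `q`-Pochhammer product `∏_{k ≥ 0} (1 + x p^k)`. -/
noncomputable def qPoch (p x : ℂ) : ℂ := ∏' k : ℕ, (1 + x * p ^ k)

/-- Gaussian binomial coefficients at `p`, defined by the `q`-Pascal rule. -/
def gaussBinom (p : ℂ) : ℕ → ℕ → ℂ
  | _, 0 => 1
  | 0, _ + 1 => 0
  | N + 1, m + 1 => gaussBinom p N m + p ^ (m + 1) * gaussBinom p N (m + 1)

lemma gaussBinom_zero_right (p : ℂ) (N : ℕ) : gaussBinom p N 0 = 1 := by
  cases N <;> rfl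

lemma gaussBinom_eq_zero (p : ℂ) {N m : ℕ} (h : N < m) : gaussBinom p N m = 0 := by
  induction N generalizing m with
  | zero =>
    obtain ⟨m, rfl⟩ := Nat.exists_eq_succ_of_ne_zero h.ne'
    rfl
  | succ N ih =>
    obtain ⟨m, rfl⟩ := Nat.exists_eq_succ_of_ne_zero (Nat.ne_zero_of_lt h)
    simp [gaussBinom, ih (Nat.lt_of_succ_lt_succ h), ih (Nat.lt_of_succ_lt h)]

/-- Gauss's `q`-binomial theorem. -/
lemma prod_one_add_mul_pow (p x : ℂ) (N : ℕ) :
    ∏ k ∈ range N, (1 + x * p ^ k) =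
      ∑ m ∈ range (N + 1), gaussBinom p N m * (p ^ m.choose 2 * x ^ m) := by
  induction N generalizing x with
  | zero => simp [gaussBinom]
  | succ N ih =>
    have hshift : ∏ k ∈ range N, (1 + x * p ^ (k + 1)) =
        ∑ m ∈ range (N + 1), gaussBinom p N m * (p ^ m.choose 2 * (x * p) ^ m) := by
      rw [← ih]
      exact prod_congr rfl fun k _ ↦ by ring
    have htop : ∑ m ∈ range (N + 1), gaussBinom p N m * (p ^ m.choose 2 * (x * p) ^ m) =
        1 + ∑ m ∈ range (N + 1),
          gaussBinom p N (m + 1) * (p ^ (m + 1).choose 2 * (x * p) ^ (m + 1)) := by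
      rw [sum_range_succ', sum_range_succ _ N, gaussBinom_eq_zero p N.lt_succ_self]
      simp [gaussBinom_zero_right, add_comm]
    rw [prod_range_succ', hshift, sum_range_succ' _ (N + 1), mul_add, mul_one, pow_zero, mul_one]
    nth_rewrite 1 [htop]
    rw [sum_mul, add_assoc, ← sum_add_distrib, add_comm]
    congr 1
    · refine sum_congr rfl fun m _ ↦ ?_
      rw [gaussBinom, Nat.choose_succ_succ' m 1, Nat.choose_one_right]
      ring
    · simp [gaussBinom]

/-- The finite `q`-factorial `∏_{k < n} (1 - p^(k+1))`. -/
def qFact (p : ℂ) (n : ℕ) : ℂ := ∏ k ∈ range n, (1 - p ^ (k + 1))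

lemma qFact_succ (p : ℂ) (n : ℕ) : qFact p (n + 1) = qFact p n * (1 - p ^ (n + 1)) :=
  prod_range_succ _ _

lemma gaussBinom_mul_qFact (p : ℂ) (m k : ℕ) :
    gaussBinom p (m + k) m * (qFact p m * qFact p k) = qFact p (m + k) := by
  induction h : m + k generalizing m k with
  | zero =>
    obtain ⟨rfl, rfl⟩ := Nat.add_eq_zero_iff.mp h
    simp [gaussBinom, qFact]
  | succ N ih =>
    rcases m with _ | m
    · obtain rfl : k = N + 1 := by omega
      simp [gaussBinom, qFact]
    · have h1 := ih m k (by omega)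
      rw [gaussBinom, qFact_succ p m, qFact_succ p N]
      rcases k with _ | k
      · obtain rfl : m = N := by omega
        rw [gaussBinom_eq_zero p m.lt_succ_self]
        linear_combination (1 - p ^ (m + 1)) * h1
      · have h2 := ih (m + 1) k (by omega)
        rw [qFact_succ] at h2
        rw [qFact_succ] at h1 ⊢
        have hN : p ^ (N + 1) = p ^ (m + 1) * p ^ (k + 1) := by
          rw [← pow_add]; congr 1; omega
        rw [hN]
        linear_combination (1 - p ^ (m + 1)) * h1 + p ^ (m + 1) * (1 - p ^ (k + 1)) * h2

section Norm

variable {p : ℂ}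

lemma summable_norm_mul_pow (hp : ‖p‖ < 1) (x : ℂ) : Summable fun k : ℕ ↦ ‖x * p ^ k‖ := by
  simpa using (summable_geometric_of_lt_one (norm_nonneg _) hp).mul_left ‖x‖

lemma multipliable_one_add_mul_pow (hp : ‖p‖ < 1) (x : ℂ) :
    Multipliable fun k : ℕ ↦ 1 + x * p ^ k :=
  multipliable_one_add_of_summable (summable_norm_mul_pow hp x)

lemma tendsto_prod_qPoch (hp : ‖p‖ < 1) (x : ℂ) :
    Tendsto (fun n ↦ ∏ k ∈ range n, (1 + x * p ^ k)) atTop (𝓝 (qPoch p x)) :=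
  (multipliable_one_add_mul_pow hp x).hasProd.tendsto_prod_nat

lemma qPoch_ne_zero (hp : ‖p‖ < 1) {x : ℂ} (hx : ∀ k : ℕ, 1 + x * p ^ k ≠ 0) : qPoch p x ≠ 0 :=
  tprod_one_add_ne_zero_of_summable hx (summable_norm_mul_pow hp x)

lemma qPoch_eq_mul (hp : ‖p‖ < 1) (x : ℂ) : qPoch p x = (1 + x) * qPoch p (p * x) := by
  refine tendsto_nhds_unique ((tendsto_prod_qPoch hp x).comp (tendsto_add_atTop_nat 1)) ?_
  refine ((tendsto_prod_qPoch hp (p * x)).const_mul (1 + x)).congr fun n ↦ ?_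
  rw [Function.comp_apply, prod_range_succ', mul_comm, pow_zero, mul_one]
  congr 1
  exact prod_congr rfl fun k _ ↦ by ring

lemma differentiable_qPoch (hp : ‖p‖ < 1) : Differentiable ℂ (qPoch p) := by
  intro x
  have hball : Metric.ball (0 : ℂ) (‖x‖ + 1) ∈ 𝓝 x :=
    Metric.isOpen_ball.mem_nhds (by simp)
  refine DifferentiableOn.differentiableAt (s := Metric.ball 0 (‖x‖ + 1)) ?_ hball
  have hprod := Summable.hasProdLocallyUniformlyOn_nat_one_add
    (f := fun (k : ℕ) (y : ℂ) ↦ y * p ^ k) (K := Metric.ball 0 (‖x‖ + 1)) Metric.isOpen_ball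
    ((summable_geometric_of_lt_one (norm_nonneg _) hp).mul_left (‖x‖ + 1))
    (.of_forall fun k y hy ↦ by
      rw [norm_mul, norm_pow]
      have : ‖y‖ < ‖x‖ + 1 := by simpa using hy
      gcongr)
    (fun k ↦ by fun_prop)
  exact TendstoLocallyUniformlyOn.differentiableOn hprod
    (.of_forall fun s ↦ by fun_prop) Metric.isOpen_ball

lemma one_sub_pow_ne_zero (hp : ‖p‖ < 1) (k : ℕ) : 1 - p ^ (k + 1) ≠ 0 := by
  intro h
  have h1 : ‖p ^ (k + 1)‖ = 1 := by rw [← sub_eq_zero.mp h, norm_one]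
  rw [norm_pow] at h1
  exact (pow_lt_one₀ (norm_nonneg _) hp k.succ_ne_zero).ne h1

lemma qFact_ne_zero (hp : ‖p‖ < 1) (n : ℕ) : qFact p n ≠ 0 :=
  prod_ne_zero_iff.mpr fun k _ ↦ one_sub_pow_ne_zero hp k

lemma qPoch_neg_self_ne_zero (hp : ‖p‖ < 1) : qPoch p (-p) ≠ 0 :=
  qPoch_ne_zero hp fun k ↦ by
    have h := one_sub_pow_ne_zero hp k
    rwa [show 1 + -p * p ^ k = 1 - p ^ (k + 1) by ring]

lemma tendsto_qFact (hp : ‖p‖ < 1) : Tendsto (qFact p) atTop (𝓝 (qPoch p (-p))) :=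
  (tendsto_prod_qPoch hp (-p)).congr fun n ↦ prod_congr rfl fun k _ ↦ by ring

lemma gaussBinom_eq (hp : ‖p‖ < 1) (m k : ℕ) :
    gaussBinom p (m + k) m = qFact p (m + k) * ((qFact p m)⁻¹ * (qFact p k)⁻¹) := by
  rw [← gaussBinom_mul_qFact]
  field_simp [qFact_ne_zero hp m, qFact_ne_zero hp k]

lemma exists_norm_gaussBinom_le (hp : ‖p‖ < 1) : ∃ M, ∀ N m, ‖gaussBinom p N m‖ ≤ M := by
  obtain ⟨A, hA⟩ := (Metric.isBounded_range_of_tendsto _ (tendsto_qFact hp)).exists_norm_le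
  obtain ⟨B, hB⟩ := (Metric.isBounded_range_of_tendsto _
    ((tendsto_qFact hp).inv₀ (qPoch_neg_self_ne_zero hp))).exists_norm_le
  have hA' n : ‖qFact p n‖ ≤ A := hA _ ⟨n, rfl⟩
  have hB' n : ‖(qFact p n)⁻¹‖ ≤ B := hB _ ⟨n, rfl⟩
  have hA0 : 0 ≤ A := (norm_nonneg _).trans (hA' 0)
  have hB0 : 0 ≤ B := (norm_nonneg _).trans (hB' 0)
  refine ⟨A * (B * B), fun N m ↦ ?_⟩
  rcases lt_or_ge N m with h | h
  · rw [gaussBinom_eq_zero p h, norm_zero]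
    positivity
  · obtain ⟨k, rfl⟩ := Nat.exists_eq_add_of_le h
    rw [gaussBinom_eq hp, norm_mul, norm_mul]
    exact mul_le_mul (hA' _) (mul_le_mul (hB' _) (hB' _) (norm_nonneg _) hB0) (by positivity) hA0

/-- The central Gaussian binomial coefficients, indexed symmetrically by `ℤ`. -/
noncomputable def centralCoeff (p : ℂ) (n : ℕ) (l : ℤ) : ℂ :=
  if l ∈ Icc (-n : ℤ) n then gaussBinom p (2 * n) (n + l).toNat else 0

lemma tendsto_centralCoeff (hp : ‖p‖ < 1) (l : ℤ) :
    Tendsto (centralCoeff p · l) atTop (𝓝 (qPoch p (-p))⁻¹) := by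
  have hplus (s : ℤ) : Tendsto (fun n : ℕ ↦ ((n : ℤ) + s).toNat) atTop atTop := by
    refine tendsto_atTop.mpr fun b ↦ ?_
    filter_upwards [eventually_ge_atTop (b + s.natAbs)] with n hn
    omega
  have hlim : Tendsto (fun n : ℕ ↦ qFact p (2 * n) *
      ((qFact p ((n : ℤ) + l).toNat)⁻¹ * (qFact p ((n : ℤ) + -l).toNat)⁻¹)) atTop
      (𝓝 (qPoch p (-p) * ((qPoch p (-p))⁻¹ * (qPoch p (-p))⁻¹))) := by
    have h0 := qPoch_neg_self_ne_zero hp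
    have hE := tendsto_qFact hp
    refine (hE.comp (tendsto_id.const_mul_atTop' two_pos)).mul
      (((hE.comp (hplus l)).inv₀ h0).mul ((hE.comp (hplus (-l))).inv₀ h0))
  rw [mul_inv_cancel_left₀ (qPoch_neg_self_ne_zero hp)] at hlim
  refine hlim.congr' ?_
  filter_upwards [eventually_ge_atTop l.natAbs] with n hn
  rw [centralCoeff, if_pos (by rw [mem_Icc]; omega)]
  have h2n : 2 * n = ((n : ℤ) + l).toNat + ((n : ℤ) + -l).toNat := by omega
  rw [h2n, gaussBinom_eq hp]

end Norm

/-- The general term of the theta series. -/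
noncomputable def thetaTerm (q z : ℂ) (l : ℤ) : ℂ := q ^ (-(l * (l + 1)) / 2) * z ^ l

lemma two_mul_neg_mul_succ_div_two (l : ℤ) : 2 * (-(l * (l + 1)) / 2) = -(l * (l + 1)) :=
  Int.mul_ediv_cancel' (dvd_neg.mpr (Int.even_mul_succ_self l).two_dvd)

section Theta

variable {q : ℂ}

lemma summable_thetaTerm (hq : 1 < ‖q‖) {z : ℂ} (hz : z ≠ 0) : Summable (thetaTerm q z) := by
  have hq0 : q ≠ 0 := norm_pos_iff.mp (one_pos.trans hq)
  set τ : ℂ := Complex.I * (Complex.log q / (2 * Real.pi)) with hτ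
  set w : ℂ := (Complex.log z - Complex.log q / 2) / (2 * Real.pi * Complex.I) with hw
  have hτim : 0 < τ.im := by
    have : τ.im = Real.log ‖q‖ / (2 * Real.pi) := by
      rw [hτ, Complex.I_mul_im, ← Complex.ofReal_ofNat, ← Complex.ofReal_mul,
        Complex.div_ofReal_re, Complex.log_re]
    rw [this]
    have := Real.log_pos hq
    positivity
  refine ((summable_jacobiTheta₂_term_iff w τ).mpr hτim).congr fun l ↦ ?_
  have h2 : (2 : ℂ) * ((-(l * (l + 1)) / 2 : ℤ) : ℂ) = -(l * (l + 1)) := by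
    exact_mod_cast two_mul_neg_mul_succ_div_two l
  have hterm : thetaTerm q z l = Complex.exp
      (((-(l * (l + 1)) / 2 : ℤ) : ℂ) * Complex.log q + l * Complex.log z) := by
    rw [Complex.exp_add, Complex.exp_int_mul, Complex.exp_int_mul, Complex.exp_log hq0,
      Complex.exp_log hz, thetaTerm]
  rw [hterm, jacobiTheta₂_term]
  congr 1
  have hw' : 2 * Real.pi * Complex.I * w = Complex.log z - Complex.log q / 2 := by
    rw [hw]; field_simp
  have hτ' : Real.pi * Complex.I * τ = -Complex.log q / 2 := by
    rw [hτ]; field_simp; rw [Complex.I_sq]; ring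
  linear_combination (l : ℂ) * hw' + (l : ℂ) ^ 2 * hτ' - Complex.log q / 2 * h2

lemma theta_mul_left (hq : q ≠ 0) {z : ℂ} (hz : z ≠ 0) :
    theta q (q * z) = z * theta q z := by
  rw [theta, theta, ← tsum_mul_left]
  refine Eq.trans (tsum_congr fun l ↦ ?_) ((Equiv.subRight (1 : ℤ)).tsum_eq _)
  have h1 := two_mul_neg_mul_succ_div_two l
  have h2 := two_mul_neg_mul_succ_div_two (l - 1)
  have h3 : -((l - 1) * (l - 1 + 1)) / 2 = -(l * (l + 1)) / 2 + l := by linarith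
  rw [Equiv.subRight_apply, h3, mul_zpow, zpow_add₀ hq, zpow_sub_one₀ hz]
  field_simp

lemma pow_mul_pow_eq_mul_thetaTerm (hq : q ≠ 0) {z : ℂ} (hz : z ≠ 0) (n m : ℕ) :
    q⁻¹ ^ m.choose 2 * (q⁻¹ * z * q ^ n) ^ m =
      z ^ n * q ^ n.choose 2 * thetaTerm q z ((m : ℤ) - n) := by
  have hchoose (j : ℕ) : 2 * (j.choose 2 : ℤ) = j * (j - 1) := by
    induction j with
    | zero => simp
    | succ j ih =>
      rw [Nat.choose_succ_succ' j 1, Nat.choose_one_right]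
      push_cast
      linear_combination ih
  have hexp : -(m.choose 2 : ℤ) + (-1 + n) * m =
      n.choose 2 + -(((m : ℤ) - n) * ((m : ℤ) - n + 1)) / 2 := by
    have h := two_mul_neg_mul_succ_div_two ((m : ℤ) - n)
    refine mul_left_cancel₀ (two_ne_zero : (2 : ℤ) ≠ 0) ?_
    linear_combination -hchoose m - hchoose n - h
  have hz' : z ^ n * z ^ ((m : ℤ) - n) = z ^ m := by
    rw [← zpow_natCast, ← zpow_add₀ hz, add_sub_cancel, zpow_natCast]
  have hq' : q⁻¹ ^ m.choose 2 * (q⁻¹ * q ^ n) ^ m = q ^ (-(m.choose 2 : ℤ) + (-1 + n) * m) := by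
    rw [zpow_add₀ hq, zpow_mul, zpow_add₀ hq, zpow_neg_one, zpow_neg, zpow_natCast, zpow_natCast,
      zpow_natCast, inv_pow]
  rw [thetaTerm, mul_right_comm q⁻¹ z, mul_pow _ z, ← mul_assoc, hq', hexp, zpow_add₀ hq,
    zpow_natCast, ← hz']
  ring

/-- The finite form of the Jacobi triple product identity. -/
lemma prod_mul_prod_eq_sum_centralCoeff (hq : q ≠ 0) {z : ℂ} (hz : z ≠ 0) (n : ℕ) :
    (∏ k ∈ range n, (1 + q⁻¹ * z * q⁻¹ ^ k)) * ∏ k ∈ range n, (1 + z⁻¹ * q⁻¹ ^ k) =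
      ∑ l ∈ Icc (-n : ℤ) n, centralCoeff q⁻¹ n l * thetaTerm q z l := by
  have hgauss := prod_one_add_mul_pow q⁻¹ (q⁻¹ * z * q ^ n) (2 * n)
  rw [two_mul, prod_range_add] at hgauss
  have hupper : ∏ k ∈ range n, (1 + q⁻¹ * z * q ^ n * q⁻¹ ^ (n + k)) =
      ∏ k ∈ range n, (1 + q⁻¹ * z * q⁻¹ ^ k) :=
    prod_congr rfl fun k _ ↦ by
      rw [pow_add, inv_pow q n]
      field_simp
  have hlower : ∏ k ∈ range n, (1 + q⁻¹ * z * q ^ n * q⁻¹ ^ k) =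
      (z ^ n * q ^ n.choose 2) * ∏ k ∈ range n, (1 + z⁻¹ * q⁻¹ ^ k) := by
    have hmono : z ^ n * q ^ n.choose 2 = ∏ k ∈ range n, z * q ^ k := by
      rw [prod_mul_distrib, prod_const, card_range, prod_pow_eq_pow_sum, sum_range_id,
        Nat.choose_two_right]
    rw [hmono, ← prod_mul_distrib, ← prod_range_reflect]
    refine prod_congr rfl fun k hk ↦ ?_
    have hn : n = (n - 1 - k) + (k + 1) := by have := mem_range.mp hk; omega
    have hpow : q ^ n * q⁻¹ ^ (n - 1 - k) = q ^ (k + 1) := by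
      nth_rewrite 1 [hn]
      rw [pow_add, mul_right_comm, ← mul_pow, mul_inv_cancel₀ hq, one_pow, one_mul]
    rw [mul_assoc, hpow, inv_pow]
    field_simp
    ring
  rw [hupper, hlower] at hgauss
  have hc : z ^ n * q ^ n.choose 2 ≠ 0 := by positivity
  apply mul_left_cancel₀ hc
  rw [mul_assoc] at hgauss
  rw [mul_comm (∏ k ∈ range n, (1 + q⁻¹ * z * q⁻¹ ^ k)), hgauss, mul_sum]
  refine sum_nbij' (fun m ↦ (m : ℤ) - n) (fun l ↦ (n + l).toNat) ?_ ?_ ?_ ?_ ?_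
  · intro m hm
    have := mem_range.mp hm
    exact mem_Icc.mpr (by omega)
  · intro l hl
    have := mem_Icc.mp hl
    exact mem_range.mpr (by omega)
  · intro m hm
    simp
  · intro l hl
    have := mem_Icc.mp hl
    omega
  · intro m hm
    have hm' : ((m : ℤ) - n) ∈ Icc (-n : ℤ) n := by
      have := mem_range.mp hm
      exact mem_Icc.mpr (by omega)
    rw [centralCoeff, if_pos hm', pow_mul_pow_eq_mul_thetaTerm hq hz, two_mul,
      add_sub_cancel, Int.toNat_natCast]
    ring

/-- The Jacobi triple product identity. -/
lemma theta_eq_qPoch_mul (hq : 1 < ‖q‖) {z : ℂ} (hz : z ≠ 0) :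
    theta q z = qPoch q⁻¹ (-q⁻¹) * (qPoch q⁻¹ (q⁻¹ * z) * qPoch q⁻¹ z⁻¹) := by
  have hq0 : q ≠ 0 := norm_pos_iff.mp (one_pos.trans hq)
  have hp : ‖q⁻¹‖ < 1 := by rw [norm_inv]; exact inv_lt_one_of_one_lt₀ hq
  obtain ⟨M, hM⟩ := exists_norm_gaussBinom_le hp
  have hM0 : 0 ≤ M := (norm_nonneg _).trans (hM 0 0)
  have hcoeff (n : ℕ) (l : ℤ) : ‖centralCoeff q⁻¹ n l‖ ≤ M := by
    rw [centralCoeff]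
    split_ifs
    · exact hM _ _
    · simpa using hM0
  have hsum := tendsto_tsum_of_dominated_convergence (𝓕 := atTop)
    (f := fun n l ↦ centralCoeff q⁻¹ n l * thetaTerm q z l)
    ((summable_thetaTerm hq hz).norm.mul_left M)
    (fun l ↦ (tendsto_centralCoeff hp l).mul_const _)
    (.of_forall fun n l ↦ by
      rw [norm_mul]
      exact mul_le_mul_of_nonneg_right (hcoeff n l) (norm_nonneg _))
  have hprod := (tendsto_prod_qPoch hp (q⁻¹ * z)).mul (tendsto_prod_qPoch hp z⁻¹)
  have hfinite (n : ℕ) : (∑' l, centralCoeff q⁻¹ n l * thetaTerm q z l) =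
      (∏ k ∈ range n, (1 + q⁻¹ * z * q⁻¹ ^ k)) * ∏ k ∈ range n, (1 + z⁻¹ * q⁻¹ ^ k) := by
    rw [prod_mul_prod_eq_sum_centralCoeff hq0 hz]
    exact tsum_eq_sum fun l hl ↦ by rw [centralCoeff, if_neg hl, zero_mul]
  have hlim := tendsto_nhds_unique (hsum.congr hfinite) hprod
  rw [tsum_mul_left] at hlim
  rw [← hlim, mul_inv_cancel_left₀ (qPoch_neg_self_ne_zero hp)]
  rfl

/-- `f` is divisible near `w` exactly once by `z - w`, with analytic quotient. -/
def HasSimpleZeroAt (f : ℂ → ℂ) (w : ℂ) : Prop :=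
  ∃ g : ℂ → ℂ, AnalyticAt ℂ g w ∧ g w ≠ 0 ∧ ∀ᶠ z in 𝓝 w, f z = (z - w) ^ 1 * g z

lemma HasSimpleZeroAt.eq_zero {f : ℂ → ℂ} {w : ℂ} (h : HasSimpleZeroAt f w) : f w = 0 := by
  obtain ⟨g, -, -, hg⟩ := h
  simpa using hg.self_of_nhds

lemma hasSimpleZeroAt_theta_neg_one (hq : 1 < ‖q‖) : HasSimpleZeroAt (theta q) (-1) := by
  have hp : ‖q⁻¹‖ < 1 := by rw [norm_inv]; exact inv_lt_one_of_one_lt₀ hq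
  have hdiff := differentiable_qPoch hp
  have hne := qPoch_neg_self_ne_zero hp
  refine ⟨fun z ↦ z⁻¹ * (qPoch q⁻¹ (-q⁻¹) * (qPoch q⁻¹ (q⁻¹ * z) * qPoch q⁻¹ (q⁻¹ * z⁻¹))),
    ?_, ?_, ?_⟩
  · have hopen : IsOpen {z : ℂ | z ≠ 0} := isOpen_ne
    refine DifferentiableOn.analyticAt (s := {z : ℂ | z ≠ 0}) (fun z hz ↦ ?_)
      (hopen.mem_nhds (by simp))
    have hinv : DifferentiableAt ℂ (fun z : ℂ ↦ z⁻¹) z := differentiableAt_inv hz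
    refine DifferentiableAt.differentiableWithinAt ?_
    exact hinv.mul (((hdiff _).comp z (by fun_prop)).mul
      ((hdiff _).comp z (hinv.const_mul q⁻¹)) |>.const_mul _)
  · simpa [inv_neg] using hne
  · filter_upwards [isOpen_ne.mem_nhds (neg_ne_zero.mpr one_ne_zero : (-1 : ℂ) ≠ 0)] with z hz
    have hz : z ≠ 0 := hz
    rw [theta_eq_qPoch_mul hq hz, qPoch_eq_mul hp z⁻¹]
    field_simp
    ring

lemma HasSimpleZeroAt.theta_mul_left (hq : q ≠ 0) {w : ℂ} (hw : w ≠ 0)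
    (h : HasSimpleZeroAt (theta q) w) : HasSimpleZeroAt (theta q) (q * w) := by
  obtain ⟨g, hg, hgw, hev⟩ := h
  have hback : q⁻¹ * (q * w) = w := inv_mul_cancel_left₀ hq w
  have hcont : Tendsto (fun z ↦ q⁻¹ * z) (𝓝 (q * w)) (𝓝 w) := by
    have : ContinuousAt (fun z ↦ q⁻¹ * z) (q * w) := by fun_prop
    simpa only [ContinuousAt, hback] using this
  refine ⟨fun z ↦ q⁻¹ * (q⁻¹ * z) * g (q⁻¹ * z), ?_, ?_, ?_⟩
  · have hlin : AnalyticAt ℂ (fun z ↦ q⁻¹ * z) (q * w) := by fun_prop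
    exact (analyticAt_const.mul hlin).mul (AnalyticAt.fun_comp (by rwa [hback]) hlin)
  · simp only [hback]
    exact mul_ne_zero (mul_ne_zero (inv_ne_zero hq) hw) hgw
  · filter_upwards [hcont.eventually hev, isOpen_ne.mem_nhds (mul_ne_zero hq hw)] with z hz hz0
    have hz0 : z ≠ 0 := hz0
    have hfun := _root_.theta_mul_left hq (mul_ne_zero (inv_ne_zero hq) hz0)
    rw [mul_inv_cancel_left₀ hq, hz] at hfun
    rw [hfun]
    field_simp

lemma HasSimpleZeroAt.theta_inv_mul_left (hq : q ≠ 0) {w : ℂ} (hw : w ≠ 0)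
    (h : HasSimpleZeroAt (theta q) w) : HasSimpleZeroAt (theta q) (q⁻¹ * w) := by
  obtain ⟨g, hg, hgw, hev⟩ := h
  have hforth : q * (q⁻¹ * w) = w := mul_inv_cancel_left₀ hq w
  have hw' : q⁻¹ * w ≠ 0 := mul_ne_zero (inv_ne_zero hq) hw
  have hcont : Tendsto (fun z ↦ q * z) (𝓝 (q⁻¹ * w)) (𝓝 w) := by
    have : ContinuousAt (fun z ↦ q * z) (q⁻¹ * w) := by fun_prop
    simpa only [ContinuousAt, hforth] using this
  refine ⟨fun z ↦ q * z⁻¹ * g (q * z), ?_, ?_, ?_⟩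
  · have hlin : AnalyticAt ℂ (fun z ↦ q * z) (q⁻¹ * w) := by fun_prop
    exact (analyticAt_const.mul (analyticAt_inv hw')).mul
      (AnalyticAt.fun_comp (by rwa [hforth]) hlin)
  · simp only [hforth]
    exact mul_ne_zero (mul_ne_zero hq (inv_ne_zero hw')) hgw
  · filter_upwards [hcont.eventually hev, isOpen_ne.mem_nhds hw'] with z hz hz0
    have hz0 : z ≠ 0 := hz0
    rw [_root_.theta_mul_left hq hz0] at hz
    apply mul_left_cancel₀ hz0
    rw [hz]
    field_simp

lemma hasSimpleZeroAt_theta_neg_zpow (hq : 1 < ‖q‖) (k : ℤ) :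
    HasSimpleZeroAt (theta q) (-q ^ k) := by
  have hq0 : q ≠ 0 := norm_pos_iff.mp (one_pos.trans hq)
  induction k with
  | zero => simpa using hasSimpleZeroAt_theta_neg_one hq
  | succ k ih =>
    have h := ih.theta_mul_left hq0 (neg_ne_zero.mpr (zpow_ne_zero _ hq0))
    rwa [mul_neg, mul_comm, ← zpow_add_one₀ hq0] at h
  | pred k ih =>
    have h := ih.theta_inv_mul_left hq0 (neg_ne_zero.mpr (zpow_ne_zero _ hq0))
    rwa [mul_neg, mul_comm, ← zpow_sub_one₀ hq0] at h

lemma exists_eq_neg_zpow_of_theta_eq_zero (hq : 1 < ‖q‖) {z : ℂ} (hz : z ≠ 0)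
    (h : theta q z = 0) : ∃ k : ℤ, z = -q ^ k := by
  have hq0 : q ≠ 0 := norm_pos_iff.mp (one_pos.trans hq)
  have hp : ‖q⁻¹‖ < 1 := by rw [norm_inv]; exact inv_lt_one_of_one_lt₀ hq
  by_contra! hk
  refine mul_ne_zero (qPoch_neg_self_ne_zero hp) (mul_ne_zero (qPoch_ne_zero hp fun k hzero ↦ ?_)
    (qPoch_ne_zero hp fun k hzero ↦ ?_)) ((theta_eq_qPoch_mul hq hz).symm.trans h)
  · refine hk (k + 1) ?_
    rw [zpow_add_one₀ hq0, zpow_natCast]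
    rw [inv_pow] at hzero
    field_simp at hzero
    linear_combination hzero
  · refine hk (-k) ?_
    rw [zpow_neg, zpow_natCast]
    rw [inv_pow] at hzero
    field_simp at hzero ⊢
    linear_combination hzero

end Theta

/-- The zero set of `Θ_q` in `ℂ*` is exactly the discrete `q`-spiral `-q^ℤ`, and every
zero is simple (order of vanishing equal to `1`). -/
theorem theta_zeros (q : ℂ) (hq : 1 < ‖q‖) :
    ({z : ℂ | z ≠ 0 ∧ theta q z = 0} = {z : ℂ | ∃ k : ℤ, z = -q ^ k}) ∧
    (∀ k : ℤ, ∃ g : ℂ → ℂ, AnalyticAt ℂ g (-q ^ k) ∧ g (-q ^ k) ≠ 0 ∧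
      ∀ᶠ z in nhds (-q ^ k), theta q z = (z - (-q ^ k)) ^ 1 * g z) := by
  refine ⟨Set.ext fun z ↦ ⟨fun h ↦ exists_eq_neg_zpow_of_theta_eq_zero hq h.1 h.2, ?_⟩,
    hasSimpleZeroAt_theta_neg_zpow hq⟩
  rintro ⟨k, rfl⟩
  exact ⟨neg_ne_zero.mpr (zpow_ne_zero _ (norm_pos_iff.mp (one_pos.trans hq))),
    (hasSimpleZeroAt_theta_neg_zpow hq k).eq_zero⟩
end

section
/- Let Q ∈ ℂ with |Q| > 1 and λ ∈ ℂ*. For every z ∈ ℂ* ∖ (−λQ^ℤ), the series Σ_{k∈ℤ} 1/Θ_Q(Q^{k+1}λ/z) converges absolutely and its sum equals 1. (This is the identity L^{[λ]}(1) = 1 for the Q-Laplace transformation.) -/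
/-- The triangular number `n(n+1)/2`, for an integer `n`. -/
def triangle (n : ℤ) : ℤ := n * (n + 1) / 2

lemma two_mul_triangle (n : ℤ) : 2 * triangle n = n * (n + 1) :=
  Int.mul_ediv_cancel' (Int.even_mul_succ_self n).two_dvd

lemma triangle_add (n m : ℤ) : triangle (n + m) = triangle n + triangle m + n * m := by
  linarith [two_mul_triangle n, two_mul_triangle m, two_mul_triangle (n + m)]

lemma triangle_one : triangle 1 = 1 := rfl

lemma triangle_zero : triangle 0 = 0 := rfl

lemma triangle_natCast_succ (n : ℕ) :
    triangle ((n + 1 : ℕ) : ℤ) = triangle n + ((n + 1 : ℕ) : ℤ) := by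
  push_cast
  rw [triangle_add, triangle_one]
  ring

lemma triangle_neg (n : ℤ) : triangle (-n) = triangle n - n := by
  linarith [two_mul_triangle n, two_mul_triangle (-n)]

lemma theta_eq_tsum_triangle (q z : ℂ) :
    theta q⁻¹ z = ∑' n : ℤ, q ^ triangle n * z ^ n := by
  refine tsum_congr fun n => ?_
  have h : -(n * (n + 1)) / 2 = -triangle n := by
    have := two_mul_triangle n
    omega
  rw [h, inv_zpow', neg_neg]

/-- The finite `q`-Pochhammer symbol `(q; q)_n`. -/
noncomputable def qFactor (q : ℂ) (n : ℕ) : ℂ := ∏ i ∈ Finset.range n, (1 - q ^ (i + 1))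

/-- The entire function `∑ q^(n(n+1)/2) x^n / (q; q)_n`, Euler's series for `∏ (1 + q^(n+1) x)`. -/
noncomputable def eulerSeries (q x : ℂ) : ℂ := ∑' n : ℕ, q ^ triangle n * x ^ n / qFactor q n

section

variable {q : ℂ}

lemma qFactor_succ (n : ℕ) : qFactor q (n + 1) = qFactor q n * (1 - q ^ (n + 1)) :=
  Finset.prod_range_succ _ _

lemma one_sub_pow_succ_ne_zero (hq : ‖q‖ < 1) (n : ℕ) : 1 - q ^ (n + 1) ≠ 0 := by
  intro h
  have h1 : ‖q‖ ^ (n + 1) < 1 := pow_lt_one₀ (norm_nonneg q) hq n.succ_ne_zero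
  rw [← norm_pow, ← sub_eq_zero.mp h, norm_one] at h1
  exact lt_irrefl _ h1

lemma qFactor_ne_zero (hq : ‖q‖ < 1) (n : ℕ) : qFactor q n ≠ 0 :=
  Finset.prod_ne_zero_iff.mpr fun i _ => one_sub_pow_succ_ne_zero hq i

lemma tendsto_pow_succ_zero (hq : ‖q‖ < 1) :
    Filter.Tendsto (fun n : ℕ => q ^ (n + 1)) Filter.atTop (nhds 0) :=
  (tendsto_pow_atTop_nhds_zero_of_norm_lt_one hq).comp (Filter.tendsto_add_atTop_nat 1)

lemma summable_of_tendsto_ratio {f r : ℕ → ℂ} {l : ℂ} (hl : ‖l‖ < 1) (hf : ∀ n, f n ≠ 0)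
    (hr : ∀ n, f (n + 1) = r n * f n) (h : Filter.Tendsto r Filter.atTop (nhds l)) :
    Summable f := by
  refine summable_of_ratio_test_tendsto_lt_one hl (Filter.Eventually.of_forall hf) ?_
  refine h.norm.congr fun n => ?_
  rw [hr, norm_mul, mul_div_cancel_right₀ _ (norm_ne_zero_iff.mpr (hf n))]

lemma summable_theta (h0 : q ≠ 0) (hq : ‖q‖ < 1) {z : ℂ} (hz : z ≠ 0) :
    Summable fun n : ℤ => q ^ triangle n * z ^ n := by
  have hne (n : ℤ) : q ^ triangle n * z ^ n ≠ 0 :=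
    mul_ne_zero (zpow_ne_zero _ h0) (zpow_ne_zero _ hz)
  apply Summable.of_nat_of_neg
  · refine summable_of_tendsto_ratio (r := fun n => q ^ (n + 1) * z) (l := 0) (by simp)
      (fun n => hne n) (fun n => ?_) (by simpa using (tendsto_pow_succ_zero hq).mul_const z)
    rw [triangle_natCast_succ, zpow_add₀ h0, zpow_natCast, zpow_natCast, zpow_natCast]
    ring
  · refine summable_of_tendsto_ratio (r := fun n => q ^ n * z⁻¹) (l := 0) (by simp)
      (fun n => hne _) (fun n => ?_)
      (by simpa using (tendsto_pow_atTop_nhds_zero_of_norm_lt_one hq).mul_const z⁻¹)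
    have h : triangle (-((n + 1 : ℕ) : ℤ)) = triangle (-n) + (n : ℤ) := by
      push_cast
      rw [triangle_neg, triangle_neg, triangle_add, triangle_one]
      ring
    rw [h, zpow_add₀ h0]
    simp only [zpow_neg, zpow_natCast, pow_succ, mul_inv]
    ring

lemma summable_eulerSeries (h0 : q ≠ 0) (hq : ‖q‖ < 1) {x : ℂ} (hx : x ≠ 0) :
    Summable fun n : ℕ => q ^ triangle n * x ^ n / qFactor q n := by
  have hlim : Filter.Tendsto (fun n : ℕ => q ^ (n + 1) * x / (1 - q ^ (n + 1)))
      Filter.atTop (nhds (0 * x / (1 - 0))) :=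
    ((tendsto_pow_succ_zero hq).mul_const x).div ((tendsto_pow_succ_zero hq).const_sub 1)
      (by simp)
  refine summable_of_tendsto_ratio (by simp) (fun n => ?_) (fun n => ?_) hlim
  · exact div_ne_zero (mul_ne_zero (zpow_ne_zero _ h0) (pow_ne_zero _ hx)) (qFactor_ne_zero hq n)
  · have h1 := one_sub_pow_succ_ne_zero hq n
    have h2 := qFactor_ne_zero hq n
    rw [triangle_natCast_succ, zpow_add₀ h0, zpow_natCast, qFactor_succ]
    field_simp
    ring

lemma eulerSeries_eq_mul (h0 : q ≠ 0) (hq : ‖q‖ < 1) {x : ℂ} (hx : x ≠ 0) :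
    eulerSeries q x = (1 + q * x) * eulerSeries q (q * x) := by
  have hs := summable_eulerSeries h0 hq hx
  have hs' := summable_eulerSeries h0 hq (mul_ne_zero h0 hx)
  have hsub : eulerSeries q x - eulerSeries q (q * x) = q * x * eulerSeries q (q * x) := by
    unfold eulerSeries
    rw [← hs.tsum_sub hs', (hs.sub hs').tsum_eq_zero_add, ← tsum_mul_left]
    simp only [pow_zero, sub_self, zero_add]
    refine tsum_congr fun n => ?_
    have h1 := one_sub_pow_succ_ne_zero hq n
    have h2 := qFactor_ne_zero hq n
    rw [triangle_natCast_succ, zpow_add₀ h0, zpow_natCast, qFactor_succ]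
    field_simp
    ring
  linear_combination hsub

lemma tendsto_eulerSeries_pow_mul (h0 : q ≠ 0) (hq : ‖q‖ < 1) {x : ℂ} (hx : x ≠ 0) :
    Filter.Tendsto (fun N : ℕ => eulerSeries q (q ^ N * x)) Filter.atTop (nhds 1) := by
  have hone : (1 : ℂ) = ∑' n : ℕ, q ^ triangle n * (0 * x) ^ n / qFactor q n := by
    rw [tsum_eq_single 0 fun n hn => by simp [hn]]
    simp [triangle_zero, qFactor]
  rw [hone]
  refine tendsto_tsum_of_dominated_convergence (summable_eulerSeries h0 hq hx).norm
    (fun n => ?_) (Filter.Eventually.of_forall fun N n => ?_)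
  · exact ((((tendsto_pow_atTop_nhds_zero_of_norm_lt_one hq).mul_const x).pow n).const_mul
      _).div_const _
  · rw [norm_div, norm_div, norm_mul, norm_mul]
    gcongr
    rw [norm_pow, norm_pow, norm_mul, norm_pow]
    gcongr
    exact mul_le_of_le_one_left (norm_nonneg x) (pow_le_one₀ (norm_nonneg q) hq.le)

lemma eulerSeries_ne_zero (h0 : q ≠ 0) (hq : ‖q‖ < 1) {x : ℂ} (hx : x ≠ 0)
    (h : ∀ n : ℕ, 1 + q ^ (n + 1) * x ≠ 0) : eulerSeries q x ≠ 0 := by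
  intro hE
  have hN (N : ℕ) : eulerSeries q (q ^ N * x) = 0 := by
    induction N with
    | zero => simpa using hE
    | succ N ih =>
      rw [eulerSeries_eq_mul h0 hq (mul_ne_zero (pow_ne_zero _ h0) hx), ← mul_assoc, ← pow_succ',
        mul_eq_zero] at ih
      exact ih.resolve_left (h N)
  have hlim := tendsto_eulerSeries_pow_mul h0 hq hx
  simp only [hN] at hlim
  exact zero_ne_one (tendsto_nhds_unique tendsto_const_nhds hlim)

lemma eulerSeries_neg_pow (h0 : q ≠ 0) (hq : ‖q‖ < 1) (n : ℕ) :
    eulerSeries q (-q ^ n) = eulerSeries q (-1) / qFactor q n := by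
  induction n with
  | zero => simp [qFactor]
  | succ n ih =>
    rw [eulerSeries_eq_mul h0 hq (neg_ne_zero.mpr (pow_ne_zero _ h0)), mul_neg, ← pow_succ',
      ← sub_eq_add_neg] at ih
    have h1 := one_sub_pow_succ_ne_zero hq n
    have h2 := qFactor_ne_zero hq n
    rw [qFactor_succ]
    field_simp at ih ⊢
    linear_combination ih

lemma eulerSeries_neg_zpow_neg_succ (h0 : q ≠ 0) (hq : ‖q‖ < 1) (n : ℕ) :
    eulerSeries q (-q ^ (-((n : ℤ) + 1))) = 0 := by
  have hstep : q * -q ^ (-((n : ℤ) + 1)) = -q ^ (-(n : ℤ)) := by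
    rw [neg_add, zpow_add₀ h0]
    field_simp
  rw [eulerSeries_eq_mul h0 hq (neg_ne_zero.mpr (zpow_ne_zero _ h0)), hstep]
  induction n with
  | zero => simp
  | succ n ih =>
    have hstep' : q * -q ^ (-((n : ℤ) + 1)) = -q ^ (-(n : ℤ)) := by
      rw [neg_add, zpow_add₀ h0]
      field_simp
    push_cast
    rw [eulerSeries_eq_mul h0 hq (neg_ne_zero.mpr (zpow_ne_zero _ h0)), hstep', ih hstep',
      mul_zero]

/-- A form of the Jacobi triple product, on the region `1 < ‖z‖` where the series for
`∏ (1 + q^n z⁻¹)⁻¹` converges. -/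
lemma theta_mul_tsum_eq (h0 : q ≠ 0) (hq : ‖q‖ < 1) {z : ℂ} (hz : 1 < ‖z‖) :
    theta q⁻¹ z * ∑' m : ℕ, (-z⁻¹) ^ m / qFactor q m = eulerSeries q (-1) * eulerSeries q z := by
  have hz0 : z ≠ 0 := by
    rintro rfl
    simp at hz
    linarith
  have hf := summable_theta h0 hq hz0
  have hg : Summable fun m : ℕ => (-z⁻¹) ^ m / qFactor q m := by
    have hlim : Filter.Tendsto (fun n : ℕ => -z⁻¹ / (1 - q ^ (n + 1)))
        Filter.atTop (nhds (-z⁻¹ / (1 - 0))) :=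
      tendsto_const_nhds.div ((tendsto_pow_succ_zero hq).const_sub 1) (by simp)
    refine summable_of_tendsto_ratio ?_ (fun n => ?_) (fun n => ?_) hlim
    · simpa using inv_lt_one_of_one_lt₀ hz
    · exact div_ne_zero (pow_ne_zero _ (by simpa using hz0)) (qFactor_ne_zero hq n)
    · rw [qFactor_succ, pow_succ]
      have h1 := one_sub_pow_succ_ne_zero hq n
      have h2 := qFactor_ne_zero hq n
      field_simp
  let e : ℤ × ℕ ≃ ℤ × ℕ :=
    { toFun := fun p => (p.1 + p.2, p.2)
      invFun := fun p => (p.1 - p.2, p.2)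
      left_inv := fun p => by simp
      right_inv := fun p => by simp }
  have hfg := summable_mul_of_summable_norm hf.norm hg.norm
  have hterm (n : ℤ) (m : ℕ) :
      q ^ triangle (n + m) * z ^ (n + m : ℤ) * ((-z⁻¹) ^ m / qFactor q m) =
        q ^ triangle n * z ^ n * (q ^ triangle m * (-q ^ n) ^ m / qFactor q m) := by
    rw [triangle_add, zpow_add₀ h0, zpow_add₀ h0, zpow_add₀ hz0, neg_pow z⁻¹, neg_pow (q ^ n),
      zpow_mul, zpow_natCast, zpow_natCast, inv_pow]
    have h2 := qFactor_ne_zero hq m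
    field_simp
  have hnonneg (n : ℕ) : q ^ triangle n * z ^ (n : ℤ) * eulerSeries q (-q ^ (n : ℤ)) =
      eulerSeries q (-1) * (q ^ triangle n * z ^ n / qFactor q n) := by
    rw [zpow_natCast, zpow_natCast, eulerSeries_neg_pow h0 hq]
    ring
  have hneg (n : ℕ) : q ^ triangle (-((n : ℤ) + 1)) * z ^ (-((n : ℤ) + 1)) *
      eulerSeries q (-q ^ (-((n : ℤ) + 1))) = 0 := by
    rw [eulerSeries_neg_zpow_neg_succ h0 hq, mul_zero]
  calc theta q⁻¹ z * ∑' m : ℕ, (-z⁻¹) ^ m / qFactor q m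
      = ∑' p : ℤ × ℕ, q ^ triangle p.1 * z ^ p.1 * ((-z⁻¹) ^ p.2 / qFactor q p.2) := by
        rw [theta_eq_tsum_triangle, tsum_mul_tsum_of_summable_norm hf.norm hg.norm]
    _ = ∑' p : ℤ × ℕ, q ^ triangle (p.1 + p.2) * z ^ (p.1 + p.2 : ℤ) *
          ((-z⁻¹) ^ p.2 / qFactor q p.2) := (e.tsum_eq _).symm
    _ = ∑' n : ℤ, ∑' m : ℕ, q ^ triangle (n + m) * z ^ (n + m : ℤ) *
          ((-z⁻¹) ^ m / qFactor q m) := (e.summable_iff.mpr hfg).tsum_prod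
    _ = ∑' n : ℤ, q ^ triangle n * z ^ n * eulerSeries q (-q ^ n) := by
        simp only [hterm, tsum_mul_left, eulerSeries]
    _ = eulerSeries q (-1) * eulerSeries q z := by
        rw [tsum_of_nat_of_neg_add_one]
        · simp only [hnonneg, hneg, tsum_mul_left, tsum_zero, add_zero]
          rfl
        · simpa only [hnonneg] using (summable_eulerSeries h0 hq hz0).mul_left _
        · simpa only [hneg] using summable_zero

lemma theta_inv_zpow_mul (h0 : q ≠ 0) {z : ℂ} (hz : z ≠ 0) (k : ℤ) :
    q ^ triangle (-k) * z ^ (-k) * theta q⁻¹ (q⁻¹ ^ k * z) = theta q⁻¹ z := by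
  rw [theta_eq_tsum_triangle, theta_eq_tsum_triangle, ← tsum_mul_left,
    ← (Equiv.addRight (-k)).tsum_eq fun n : ℤ => q ^ triangle n * z ^ n]
  refine tsum_congr fun n => ?_
  rw [Equiv.coe_addRight, triangle_add, zpow_add₀ h0, zpow_add₀ h0, zpow_add₀ hz, mul_zpow,
    inv_zpow', ← zpow_mul, mul_comm n (-k)]
  ring

lemma theta_ne_zero (h0 : q ≠ 0) (hq : ‖q‖ < 1) {z : ℂ} (hz : z ≠ 0)
    (h : ∀ k : ℤ, z ≠ -q ^ k) : theta q⁻¹ z ≠ 0 := by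
  have hlarge {w : ℂ} (hw : 1 < ‖w‖) (h : ∀ k : ℤ, w ≠ -q ^ k) : theta q⁻¹ w ≠ 0 := by
    have hw0 : w ≠ 0 := by
      rintro rfl
      simp at hw
      linarith
    have hE : eulerSeries q w ≠ 0 := by
      refine eulerSeries_ne_zero h0 hq hw0 fun n hn => h (-((n : ℤ) + 1)) ?_
      have hp : q ^ ((n : ℤ) + 1) = q ^ (n + 1) := by exact_mod_cast zpow_natCast q (n + 1)
      have hp0 := pow_ne_zero (n + 1) h0
      rw [zpow_neg, hp]
      field_simp
      linear_combination hn
    have hE1 : eulerSeries q (-1) ≠ 0 := by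
      refine eulerSeries_ne_zero h0 hq (by simp) fun n hn => one_sub_pow_succ_ne_zero hq n ?_
      linear_combination hn
    exact left_ne_zero_of_mul (theta_mul_tsum_eq h0 hq hw ▸ mul_ne_zero hE1 hE)
  have hqinv : 1 < ‖q⁻¹‖ := by
    rw [norm_inv]
    exact (one_lt_inv₀ (norm_pos_iff.mpr h0)).mpr hq
  obtain ⟨N, hN⟩ := pow_unbounded_of_one_lt ‖z‖⁻¹ hqinv
  rw [← theta_inv_zpow_mul h0 hz N]
  refine mul_ne_zero (mul_ne_zero (zpow_ne_zero _ h0) (zpow_ne_zero _ hz)) (hlarge ?_ ?_)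
  · rw [norm_mul, zpow_natCast, norm_pow]
    exact (inv_lt_iff_one_lt_mul₀ (norm_pos_iff.mpr hz)).mp hN
  · intro k hk
    refine h (N + k) ?_
    rw [zpow_add₀ h0, ← mul_neg, ← hk, inv_zpow, mul_inv_cancel_left₀ (zpow_ne_zero _ h0)]

lemma hasSum_one_div_theta (h0 : q ≠ 0) (hq : ‖q‖ < 1) {w : ℂ} (hw : w ≠ 0)
    (h : ∀ k : ℤ, w ≠ -q ^ k) :
    HasSum (fun k : ℤ => 1 / theta q⁻¹ (q⁻¹ ^ k * w)) 1 := by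
  have hT := theta_ne_zero h0 hq hw h
  have hterm (k : ℤ) : 1 / theta q⁻¹ (q⁻¹ ^ k * w) =
      q ^ triangle (-k) * w ^ (-k) / theta q⁻¹ w := by
    have hk := theta_inv_zpow_mul h0 hw k
    rw [div_eq_div_iff (right_ne_zero_of_mul (hk ▸ hT)) hT, hk, one_mul]
  simp only [hterm]
  have hs := (summable_theta h0 hq hw).hasSum
  rw [← theta_eq_tsum_triangle] at hs
  simpa [Function.comp_def, div_self hT] using
    ((Equiv.neg ℤ).hasSum_iff.mpr hs).div_const (theta q⁻¹ w)

end

/-- The identity `L^{[λ]}(1) = 1`: for `z ∉ -λQ^ℤ`, `Σ_{k∈ℤ} 1/Θ_Q(Q^{k+1}λ/z)`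
converges absolutely and sums to `1`. -/
theorem qLaplace_one (Q : ℂ) (hQ : 1 < ‖Q‖) (lam : ℂ) (hlam : lam ≠ 0) (z : ℂ) (hz : z ≠ 0)
    (hzS : ∀ k : ℤ, z ≠ -lam * Q ^ k) :
    Summable (fun k : ℤ => ‖1 / theta Q (Q ^ (k + 1) * lam / z)‖) ∧
    ∑' k : ℤ, 1 / theta Q (Q ^ (k + 1) * lam / z) = 1 := by
  have hQ0 : Q ≠ 0 := norm_pos_iff.mp (one_pos.trans hQ)
  have hq : ‖Q⁻¹‖ < 1 := by
    rw [norm_inv]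
    exact inv_lt_one_of_one_lt₀ hQ
  have hw (k : ℤ) : Q * lam / z ≠ -Q⁻¹ ^ k := by
    intro hk
    refine hzS (k + 1) ?_
    have hp := zpow_ne_zero k hQ0
    rw [inv_zpow] at hk
    rw [zpow_add_one₀ hQ0]
    field_simp at hk
    linear_combination hk
  have hsum := hasSum_one_div_theta (inv_ne_zero hQ0) hq
    (div_ne_zero (mul_ne_zero hQ0 hlam) hz) hw
  have harg (k : ℤ) : Q ^ k * (Q * lam / z) = Q ^ (k + 1) * lam / z := by
    rw [zpow_add_one₀ hQ0]
    ring
  simp only [inv_inv, harg] at hsum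
  exact ⟨hsum.summable.norm, hsum.tsum_eq⟩
end
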